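/- arXiv:1512.08898 — 5 statements merged into one kernel-verified Lean document; each statement's English description precedes it below -/
import Mathlib

section
/- Let M be a commutative monoid. There is a unique λ-ring structure σ_t on the monoid ring ℤ[M] such that σ_t(m) = ∑_{n≥0} m^n t^n (i.e. σ^n(m) = m^n for all n ≥ 0) for every element m of M, viewed as an element of ℤ[M]. -/
/-- A λ-ring structure on a commutative ring `R`, given by its coefficient
operations `σ : ℕ → R → R`: one requires `σ 0 a = 1`, `σ 1 a = a`,
`σ_t(0) = 1` and `σ_t(a+b) = σ_t(a)·σ_t(b)` in `R[[t]]`. -/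
def IsLambdaRing {R : Type*} [CommRing R] (σ : ℕ → R → R) : Prop :=
  (∀ a : R, σ 0 a = 1) ∧ (∀ a : R, σ 1 a = a) ∧
  (PowerSeries.mk (fun n => σ n (0 : R)) = 1) ∧
  (∀ a b : R, PowerSeries.mk (fun n => σ n (a + b)) =
      PowerSeries.mk (fun n => σ n a) * PowerSeries.mk (fun n => σ n b))

open PowerSeries in
/-- The geometric series `∑ xⁿ tⁿ` as a unit of `R[[t]]`. -/
noncomputable def PowerSeries.geomUnit {R : Type*} [CommRing R] (x : R) : (PowerSeries R)ˣ :=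
  IsUnit.unit (a := PowerSeries.mk fun n => x ^ n) <| by
    rw [isUnit_iff_constantCoeff, ← coeff_zero_eq_constantCoeff_apply, coeff_mk, pow_zero]
    exact isUnit_one

@[simp]
theorem PowerSeries.coe_geomUnit {R : Type*} [CommRing R] (x : R) :
    (geomUnit x : PowerSeries R) = PowerSeries.mk fun n => x ^ n :=
  rfl

theorem MonoidAlgebra.int_addHom_ext {M A : Type*} [CommMonoid M] [AddMonoid A]
    {f g : MonoidAlgebra ℤ M →+ A}
    (h : ∀ m, f (MonoidAlgebra.of ℤ M m) = g (MonoidAlgebra.of ℤ M m)) : f = g := by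
  refine MonoidAlgebra.addMonoidHom_ext fun m n => ?_
  exact DFunLike.congr_fun (AddMonoidHom.ext_int
    (f := f.comp (MonoidAlgebra.singleAddHom m)) (g := g.comp (MonoidAlgebra.singleAddHom m))
    (h m)) n

/-- The total operation `σ_t` of a λ-ring, as a homomorphism from the additive group to the
multiplicative monoid of power series. -/
def IsLambdaRing.totalHom {R : Type*} [CommRing R] {σ : ℕ → R → R} (h : IsLambdaRing σ) :
    R →+ Additive (PowerSeries R) where
  toFun a := Additive.ofMul (PowerSeries.mk fun n => σ n a)
  map_zero' := congrArg Additive.ofMul h.2.2.1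
  map_add' a b := congrArg Additive.ofMul (h.2.2.2 a b)

theorem IsLambdaRing.ext_of {M : Type*} [CommMonoid M]
    {σ τ : ℕ → MonoidAlgebra ℤ M → MonoidAlgebra ℤ M} (hσ : IsLambdaRing σ) (hτ : IsLambdaRing τ)
    (h : ∀ (m : M) (n : ℕ), σ n (MonoidAlgebra.of ℤ M m) = τ n (MonoidAlgebra.of ℤ M m)) :
    σ = τ := by
  have key : hσ.totalHom = hτ.totalHom := MonoidAlgebra.int_addHom_ext fun m =>
    congrArg (fun s => Additive.ofMul (PowerSeries.mk s)) (funext (h m))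
  funext n a
  have ha := congrArg (fun s => PowerSeries.coeff n s.toMul) (DFunLike.congr_fun key a)
  simpa [IsLambdaRing.totalHom] using ha

/-- The additive-to-multiplicative homomorphism `ℤ[M] → ℤ[M][[t]]ˣ` sending `m` to `∑ mⁿ tⁿ`. -/
noncomputable def MonoidAlgebra.sigmaHom (M : Type*) [CommMonoid M] :
    MonoidAlgebra ℤ M →+ Additive (PowerSeries (MonoidAlgebra ℤ M))ˣ :=
  (Finsupp.liftAddHom fun m => zmultiplesHom _
      (Additive.ofMul (PowerSeries.geomUnit (MonoidAlgebra.of ℤ M m)))).comp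
    MonoidAlgebra.coeffAddEquiv.toAddMonoidHom

theorem MonoidAlgebra.sigmaHom_of {M : Type*} [CommMonoid M] (m : M) :
    MonoidAlgebra.sigmaHom M (MonoidAlgebra.of ℤ M m) =
      Additive.ofMul (PowerSeries.geomUnit (MonoidAlgebra.of ℤ M m)) := by
  simp [MonoidAlgebra.sigmaHom]

/-- The power series `σ_t(a)` over the monoid ring `ℤ[M]`. -/
noncomputable def MonoidAlgebra.sigmaSeries {M : Type*} [CommMonoid M] (a : MonoidAlgebra ℤ M) :
    PowerSeries (MonoidAlgebra ℤ M) :=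
  ((MonoidAlgebra.sigmaHom M a).toMul : (PowerSeries (MonoidAlgebra ℤ M))ˣ)

namespace MonoidAlgebra

variable {M : Type*} [CommMonoid M]

theorem sigmaSeries_zero : sigmaSeries (0 : MonoidAlgebra ℤ M) = 1 := by
  simp [sigmaSeries]

theorem sigmaSeries_add (a b : MonoidAlgebra ℤ M) :
    sigmaSeries (a + b) = sigmaSeries a * sigmaSeries b := by
  simp [sigmaSeries]

theorem sigmaSeries_of (m : M) :
    sigmaSeries (of ℤ M m) = PowerSeries.mk fun n => of ℤ M m ^ n := by
  rw [sigmaSeries, sigmaHom_of, toMul_ofMul, PowerSeries.coe_geomUnit]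

theorem constantCoeff_sigmaSeries (a : MonoidAlgebra ℤ M) :
    PowerSeries.constantCoeff (sigmaSeries a) = 1 := by
  let f : MonoidAlgebra ℤ M →+ Additive (MonoidAlgebra ℤ M) :=
    { toFun := fun a => Additive.ofMul (PowerSeries.constantCoeff (sigmaSeries a))
      map_zero' := by simp [sigmaSeries_zero]
      map_add' := fun a b => by simp [sigmaSeries_add] }
  have hf : f = 0 := int_addHom_ext fun m => by
    change Additive.ofMul (PowerSeries.constantCoeff (sigmaSeries (of ℤ M m))) = 0
    rw [sigmaSeries_of, ← PowerSeries.coeff_zero_eq_constantCoeff_apply, PowerSeries.coeff_mk,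
      pow_zero, ofMul_one]
  exact congrArg Additive.toMul (DFunLike.congr_fun hf a)

theorem coeff_one_sigmaSeries (a : MonoidAlgebra ℤ M) :
    PowerSeries.coeff 1 (sigmaSeries a) = a := by
  let f : MonoidAlgebra ℤ M →+ MonoidAlgebra ℤ M :=
    { toFun := fun a => PowerSeries.coeff 1 (sigmaSeries a)
      map_zero' := by simp [sigmaSeries_zero, PowerSeries.coeff_one]
      map_add' := fun a b => by
        simp [sigmaSeries_add, PowerSeries.coeff_one_mul, constantCoeff_sigmaSeries] }
  have hf : f = AddMonoidHom.id _ := int_addHom_ext fun m => by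
    change PowerSeries.coeff 1 (sigmaSeries (of ℤ M m)) = of ℤ M m
    rw [sigmaSeries_of, PowerSeries.coeff_mk, pow_one]
  exact DFunLike.congr_fun hf a

theorem mk_coeff_sigmaSeries (a : MonoidAlgebra ℤ M) :
    PowerSeries.mk (fun n => PowerSeries.coeff n (sigmaSeries a)) = sigmaSeries a :=
  PowerSeries.ext fun n => PowerSeries.coeff_mk n _

theorem isLambdaRing_coeff_sigmaSeries :
    IsLambdaRing fun n (a : MonoidAlgebra ℤ M) => PowerSeries.coeff n (sigmaSeries a) := by
  refine ⟨fun a => ?_, coeff_one_sigmaSeries, ?_, fun a b => ?_⟩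
  · exact (PowerSeries.coeff_zero_eq_constantCoeff_apply _).trans (constantCoeff_sigmaSeries a)
  · rw [mk_coeff_sigmaSeries, sigmaSeries_zero]
  · rw [mk_coeff_sigmaSeries, mk_coeff_sigmaSeries, mk_coeff_sigmaSeries, sigmaSeries_add]

end MonoidAlgebra


/-- For a commutative monoid `M`, there is a unique λ-ring structure `σ` on the
monoid ring `ℤ[M]` such that `σⁿ(m) = mⁿ` for every `m ∈ M` and all `n`. -/
theorem monoid_ring_lambda_structure (M : Type*) [CommMonoid M] :
    ∃! σ : ℕ → MonoidAlgebra ℤ M → MonoidAlgebra ℤ M,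
      IsLambdaRing σ ∧
      ∀ (m : M) (n : ℕ),
        σ n (MonoidAlgebra.of ℤ M m) = (MonoidAlgebra.of ℤ M m) ^ n := by
  refine ⟨fun n a => PowerSeries.coeff n (MonoidAlgebra.sigmaSeries a),
    ⟨MonoidAlgebra.isLambdaRing_coeff_sigmaSeries, fun m n => ?_⟩, fun τ hτ => ?_⟩
  · change PowerSeries.coeff n (MonoidAlgebra.sigmaSeries (MonoidAlgebra.of ℤ M m)) = _
    rw [MonoidAlgebra.sigmaSeries_of, PowerSeries.coeff_mk]
  · refine hτ.1.ext_of MonoidAlgebra.isLambdaRing_coeff_sigmaSeries fun m n => ?_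
    rw [hτ.2, MonoidAlgebra.sigmaSeries_of, PowerSeries.coeff_mk]
end

section
/- Let (R, σ_t, F•R) be a complete filtered λ-ring. For every a ∈ F¹R the series Sym(a) := ∑_{n≥0} σ^n(a) converges in R (since σ^n(a) ∈ F^nR) and lies in 1 + F¹R, and the resulting map Sym : (F¹R, +, 0) → (1 + F¹R, ·, 1) is an isomorphism of groups. -/
/-- Partial sums of a Cauchy product agree with the product of the partial sums modulo `F i`,
when the `n`-th terms lie in `F n`. -/
theorem sum_mul_sum_sub_cauchy_mem {R : Type*} [CommRing R] (F : ℕ → Ideal R)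
    (hFmono : ∀ i j : ℕ, i ≤ j → F j ≤ F i)
    (hFmul : ∀ i j : ℕ, F i * F j ≤ F (i + j))
    (f g : ℕ → R) (hf : ∀ n, f n ∈ F n) (hg : ∀ n, g n ∈ F n) (i : ℕ) :
    (∑ n ∈ Finset.range i, f n) * (∑ n ∈ Finset.range i, g n) -
      ∑ n ∈ Finset.range i, ∑ p ∈ Finset.HasAntidiagonal.antidiagonal n, f p.1 * g p.2 ∈ F i := by
  have h : ∑ n ∈ Finset.range i, ∑ p ∈ Finset.HasAntidiagonal.antidiagonal n, f p.1 * g p.2 =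
      ∑ m ∈ Finset.range i, ∑ k ∈ Finset.range (i - m), f m * g k := by
    rw [← Finset.sum_range_diag_flip]
    exact Finset.sum_congr rfl fun n _ =>
      Finset.Nat.sum_antidiagonal_eq_sum_range_succ (fun a b => f a * g b) n
  rw [h, Finset.sum_mul_sum, ← Finset.sum_sub_distrib]
  refine Ideal.sum_mem _ fun m _ => ?_
  rw [← Finset.sum_range_add_sum_Ico _ (Nat.sub_le i m), add_sub_cancel_left]
  refine Ideal.sum_mem _ fun k hk => ?_
  have hk := (Finset.mem_Ico.mp hk).1
  exact hFmono i (m + k) (by omega) (hFmul m k (Ideal.mul_mem_mul (hf m) (hg k)))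

/-- Let `(R, σ, F)` be a complete filtered λ-ring. For `a ∈ F¹R` the series
`Sym(a) = ∑_{n≥0} σⁿ(a)` converges (its partial sums eventually agree with the
limit modulo any `FⁱR`), `Sym(a) ∈ 1 + F¹R`, and
`Sym : (F¹R, +, 0) → (1 + F¹R, ·, 1)` is a group isomorphism. -/
theorem sym_group_isomorphism {R : Type*} [CommRing R]
    (σ : ℕ → R → R) (hσ : IsLambdaRing σ)
    (F : ℕ → Ideal R)
    (hF0 : F 0 = ⊤)
    (hFmono : ∀ i j : ℕ, i ≤ j → F j ≤ F i)
    (hFmul : ∀ i j : ℕ, F i * F j ≤ F (i + j))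
    (hFσ : ∀ (i n : ℕ) (a : R), a ∈ F i → σ n a ∈ F (i * n))
    (hsep : ∀ a : R, (∀ i : ℕ, a ∈ F i) → a = 0)
    (hcomplete : ∀ s : ℕ → R, (∀ i : ℕ, s (i + 1) - s i ∈ F i) →
      ∃ b : R, ∀ i : ℕ, b - s i ∈ F i) :
    ∃ Sym : R → R,
      (∀ a ∈ F 1, ∀ i : ℕ, Sym a - ∑ n ∈ Finset.range i, σ n a ∈ F i) ∧
      (∀ a ∈ F 1, Sym a - 1 ∈ F 1) ∧
      Sym 0 = 1 ∧
      (∀ a ∈ F 1, ∀ b ∈ F 1, Sym (a + b) = Sym a * Sym b) ∧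
      (∀ u : R, u - 1 ∈ F 1 → ∃! a : R, a ∈ F 1 ∧ Sym a = u) := by
  obtain ⟨h0, h1, hz, hadd⟩ := hσ
  have hconv : ∀ a : R, ∃ b : R, a ∈ F 1 → ∀ i : ℕ, b - ∑ n ∈ Finset.range i, σ n a ∈ F i := by
    intro a
    by_cases ha : a ∈ F 1
    · obtain ⟨b, hb⟩ := hcomplete (fun i => ∑ n ∈ Finset.range i, σ n a) fun i => by
        simpa [Finset.sum_range_succ] using hFσ 1 i a ha
      exact ⟨b, fun _ => hb⟩
    · exact ⟨0, fun h => absurd h ha⟩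
  choose Sym hSym using hconv
  have eq_of_sub_mem : ∀ x y : R, (∀ i, x - y ∈ F i) → x = y := fun x y h =>
    sub_eq_zero.mp (hsep _ h)
  have sym_sub_one_mem : ∀ k, 1 ≤ k → ∀ a ∈ F k, Sym a - 1 - a ∈ F (k + 1) := by
    intro k hk a ha
    have h := hSym a (hFmono 1 k hk ha) (k + 1)
    rw [← Finset.sum_range_add_sum_Ico _ (show 2 ≤ k + 1 by omega)] at h
    have ht : ∑ n ∈ Finset.Ico 2 (k + 1), σ n a ∈ F (k + 1) := by
      refine Ideal.sum_mem _ fun n hn => ?_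
      have hn := (Finset.mem_Ico.mp hn).1
      exact hFmono (k + 1) (k * n) (by nlinarith) (hFσ k n a ha)
    have h' := (F (k + 1)).add_mem h ht
    simp only [Finset.sum_range_succ, Finset.sum_range_zero, h0, h1] at h'
    convert h' using 1
    ring
  have sym_sub_one_mem' : ∀ k, 1 ≤ k → ∀ a ∈ F k, Sym a - 1 ∈ F k := by
    intro k hk a ha
    have h := (F k).add_mem (hFmono k (k + 1) (by omega) (sym_sub_one_mem k hk a ha)) ha
    simpa using h
  have sym_zero : Sym 0 = 1 := by
    refine eq_of_sub_mem _ _ fun i => ?_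
    have h := sym_sub_one_mem' (i + 1) (by omega) 0 (F (i + 1)).zero_mem
    exact hFmono i (i + 1) (by omega) h
  have sym_add : ∀ a ∈ F 1, ∀ b ∈ F 1, Sym (a + b) = Sym a * Sym b := by
    intro a ha b hb
    refine eq_of_sub_mem _ _ fun i => ?_
    have hc := sum_mul_sum_sub_cauchy_mem F hFmono hFmul (fun n => σ n a) (fun n => σ n b)
      (fun n => by simpa using hFσ 1 n a ha) (fun n => by simpa using hFσ 1 n b hb) i
    have hs : ∀ n, σ n (a + b) = ∑ p ∈ Finset.HasAntidiagonal.antidiagonal n, σ p.1 a * σ p.2 b := by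
      intro n
      have := congrArg (PowerSeries.coeff n) (hadd a b)
      simpa [PowerSeries.coeff_mul] using this
    simp only [← hs] at hc
    have hab := hSym _ ((F 1).add_mem ha hb) i
    have e1 := (F i).mul_mem_right (Sym b) (hSym a ha i)
    have e2 := (F i).mul_mem_left (∑ n ∈ Finset.range i, σ n a) (hSym b hb i)
    convert (F i).sub_mem hab ((F i).add_mem ((F i).add_mem e1 e2) hc) using 1
    ring
  have sym_neg : ∀ a ∈ F 1, Sym a * Sym (-a) = 1 := by
    intro a ha
    rw [← sym_add a ha _ ((F 1).neg_mem ha), add_neg_cancel, sym_zero]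
  refine ⟨Sym, hSym, sym_sub_one_mem' 1 le_rfl, sym_zero, sym_add, fun u hu => ?_⟩
  refine existsUnique_of_exists_of_unique ?_ ?_
  · let s : ℕ → R := Nat.rec 0 fun _ x => x + (u * Sym (-x) - 1)
    have hs : ∀ k, s (k + 1) = s k + (u * Sym (-s k) - 1) := fun _ => rfl
    have hinv : ∀ k, s k ∈ F 1 ∧ u * Sym (-s k) - 1 ∈ F (k + 1) := by
      intro k
      induction k with
      | zero =>
        have hs0 : s 0 = 0 := rfl
        simpa [hs0, sym_zero] using hu
      | succ k ih =>
        obtain ⟨hk, hd⟩ := ih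
        have hd1 := hFmono 1 (k + 1) (by omega) hd
        rw [hs]
        set d := u * Sym (-s k) - 1 with hd_def
        refine ⟨(F 1).add_mem hk hd1, ?_⟩
        rw [neg_add, sym_add _ ((F 1).neg_mem hk) _ ((F 1).neg_mem hd1)]
        have h1 := (F (k + 2)).mul_mem_left (1 + d)
          (sym_sub_one_mem (k + 1) (by omega) (-d) ((F (k + 1)).neg_mem hd))
        have h2 := hFmono (k + 2) (k + 1 + (k + 1)) (by omega)
          (hFmul _ _ (Ideal.mul_mem_mul hd hd))
        have hu' : u * Sym (-s k) = 1 + d := by rw [hd_def]; ring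
        rw [← mul_assoc, hu']
        convert (F (k + 2)).sub_mem h1 h2 using 1
        ring
    obtain ⟨b, hb⟩ := hcomplete s fun i => by
      rw [hs, add_sub_cancel_left]
      exact hFmono i (i + 1) (by omega) (hinv i).2
    have hb1 : b ∈ F 1 := by
      simpa using (F 1).add_mem (hb 1) (hinv 1).1
    have hub : u * Sym (-b) = 1 := by
      refine eq_of_sub_mem _ _ fun i => hFmono i (i + 1) (by omega) ?_
      have hdi := (F (i + 1)).neg_mem (hb (i + 1))
      have hmul := sym_add _ ((F 1).neg_mem (hinv (i + 1)).1) _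
        (hFmono 1 (i + 1) (by omega) hdi)
      rw [show -s (i + 1) + -(b - s (i + 1)) = -b by ring] at hmul
      have e1 := (F (i + 1)).mul_mem_left (u * Sym (-s (i + 1)))
        (sym_sub_one_mem' (i + 1) (by omega) _ hdi)
      have e2 := hFmono (i + 1) (i + 1 + 1) (by omega) (hinv (i + 1)).2
      rw [hmul]
      convert (F (i + 1)).add_mem e1 e2 using 1
      ring
    refine ⟨b, hb1, ?_⟩
    linear_combination u * sym_neg b hb1 - Sym b * hub
  · rintro a b ⟨ha, rfl⟩ ⟨hb, hab⟩
    have hd1 := (F 1).sub_mem ha hb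
    have hd : Sym (a - b) = 1 := by
      rw [sub_eq_add_neg, sym_add a ha _ ((F 1).neg_mem hb), ← hab, sym_neg b hb]
    have hmem : ∀ k, a - b ∈ F (k + 1) := by
      intro k
      induction k with
      | zero => exact hd1
      | succ k ih =>
        have h := sym_sub_one_mem (k + 1) (by omega) _ ih
        rw [hd, sub_self, zero_sub] at h
        exact neg_mem_iff.mp h
    exact eq_of_sub_mem _ _ fun i => hFmono i (i + 1) (by omega) (hmem i)
end

section
/- Let (R, σ_t, F•R) be a filtered λ-ring. Then the Adams operations satisfy ψ^n(a) ∈ F^{in}R for every a ∈ FⁱR, every i ≥ 0 and every n ≥ 1. -/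
/-- `ψ` is the family of Adams operations associated to `σ`:
`ψ_t(a) · σ_t(a) = t · σ_t(a)′` in `R[[t]]`. -/
def IsAdams {R : Type*} [CommRing R] (σ ψ : ℕ → R → R) : Prop :=
  ∀ a : R,
    (PowerSeries.mk fun n => if n = 0 then 0 else ψ n a) *
        PowerSeries.mk (fun n => σ n a) =
      PowerSeries.mk fun n => (n : R) * σ n a

/-- In a filtered λ-ring, the Adams operations satisfy `ψⁿ(a) ∈ F^{i·n}R`
for every `a ∈ FⁱR`, every `i ≥ 0` and every `n ≥ 1`. -/
theorem adams_preserve_filtration {R : Type*} [CommRing R]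
    (σ ψ : ℕ → R → R) (hσ : IsLambdaRing σ) (hψ : IsAdams σ ψ)
    (F : ℕ → Ideal R)
    (hF0 : F 0 = ⊤)
    (hFmono : ∀ i j : ℕ, i ≤ j → F j ≤ F i)
    (hFmul : ∀ i j : ℕ, F i * F j ≤ F (i + j))
    (hFσ : ∀ (i n : ℕ) (a : R), a ∈ F i → σ n a ∈ F (i * n)) :
    ∀ (i n : ℕ) (a : R), 1 ≤ n → a ∈ F i → ψ n a ∈ F (i * n) := by
  intro i n a hn ha
  induction n using Nat.strong_induction_on with
  | _ n ih =>
    have h := congrArg (PowerSeries.coeff n) (hψ a)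
    simp only [PowerSeries.coeff_mul, PowerSeries.coeff_mk] at h
    rw [Finset.Nat.sum_antidiagonal_eq_sum_range_succ
      (fun k l => (if k = 0 then 0 else ψ k a) * σ l a), Finset.sum_range_succ,
      if_neg (by omega), Nat.sub_self, hσ.1 a, mul_one] at h
    rw [eq_sub_of_add_eq' h]
    refine (F (i * n)).sub_mem ((F (i * n)).mul_mem_left _ (hFσ i n a ha))
      ((F (i * n)).sum_mem fun k hk => ?_)
    have hkn : k < n := Finset.mem_range.mp hk
    split_ifs with hk0
    · simp
    · have hmem := hFmul _ _ (Ideal.mul_mem_mul (ih k hkn (by omega)) (hFσ i (n - k) a ha))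
      rwa [← Nat.mul_add, Nat.add_sub_cancel' hkn.le] at hmem
end

section
/- Fix integers m, n ≥ 1 and consider the polynomial ring ℤ[y₁,…,y_m, x₁,…,x_{mn}]. Let h_m denote the complete homogeneous symmetric polynomial of degree m evaluated at the finite family of all products y_j·x_{i₁}·x_{i₂}·⋯·x_{i_n} with 1 ≤ j ≤ m and 1 ≤ i₁ ≤ ⋯ ≤ i_n ≤ mn. Then there is a unique polynomial P^{m,n} ∈ ℤ[Y₁,…,Y_m, X₁,…,X_{mn}] such that h_m of this family equals P^{m,n}(h₁(y),…,h_m(y), h₁(x),…,h_{mn}(x)), where h_d(y) and h_d(x) denote the complete homogeneous symmetric polynomials of degree d in the variables y₁,…,y_m and x₁,…,x_{mn} respectively. -/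
open MvPolynomial

/-- The complete homogeneous symmetric function of degree `d` of a finite
family `z : ι → A` of elements of a commutative ring: the sum of all products
`z_{i₁}·z_{i₂}·⋯·z_{i_d}` over multisets `{i₁ ≤ ⋯ ≤ i_d}` of indices. -/
def hsym {ι : Type*} [Fintype ι] [DecidableEq ι] {A : Type*} [CommRing A]
    (d : ℕ) (z : ι → A) : A :=
  ∑ s ∈ (Finset.univ : Finset ι).sym d, ((s : Multiset ι).map z).prod

section Duality

variable {ι A : Type*} [DecidableEq ι] [CommRing A]

theorem sum_sym_insert_succ (z : ι → A) {a : ι} {s : Finset ι} (ha : a ∉ s) (d : ℕ) :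
    ∑ t ∈ (insert a s).sym (d + 1), ((t : Multiset ι).map z).prod =
      ∑ t ∈ s.sym (d + 1), ((t : Multiset ι).map z).prod +
        z a * ∑ t ∈ (insert a s).sym d, ((t : Multiset ι).map z).prod := by
  have hsplit : (insert a s).sym (d + 1) =
      s.sym (d + 1) ∪ ((insert a s).sym d).image (Sym.cons a) := by
    ext t
    simp only [Finset.mem_union, Finset.mem_image, Finset.mem_sym_iff]
    constructor
    · intro h
      by_cases hat : a ∈ t
      · obtain ⟨u, rfl⟩ := Sym.exists_cons_of_mem hat
        exact Or.inr ⟨u, fun b hb => h b (Sym.mem_cons_of_mem hb), rfl⟩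
      · refine Or.inl fun b hb => (Finset.mem_insert.1 (h b hb)).resolve_left ?_
        rintro rfl
        exact hat hb
    · rintro (h | ⟨u, hu, rfl⟩) b hb
      · exact Finset.mem_insert_of_mem (h b hb)
      · rcases Sym.mem_cons.1 hb with rfl | hb
        · exact Finset.mem_insert_self _ _
        · exact hu b hb
  have hdisj : Disjoint (s.sym (d + 1)) (((insert a s).sym d).image (Sym.cons a)) := by
    rw [Finset.disjoint_left]
    intro t ht ht'
    obtain ⟨u, -, rfl⟩ := Finset.mem_image.1 ht'
    exact ha (Finset.mem_sym_iff.1 ht a (Sym.mem_cons_self a u))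
  rw [hsplit, Finset.sum_union hdisj,
    Finset.sum_image fun t _ u _ h => (Sym.cons_inj_right a t u).1 h, Finset.mul_sum]
  simp [Sym.coe_cons]

theorem sum_powersetCard_insert_succ (z : ι → A) {a : ι} {s : Finset ι} (ha : a ∉ s) (d : ℕ) :
    ∑ t ∈ (insert a s).powersetCard (d + 1), ∏ i ∈ t, z i =
      ∑ t ∈ s.powersetCard (d + 1), ∏ i ∈ t, z i +
        z a * ∑ t ∈ s.powersetCard d, ∏ i ∈ t, z i := by
  have hmem : ∀ {k : ℕ} {t : Finset ι}, t ∈ s.powersetCard k → a ∉ t := fun ht h =>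
    ha ((Finset.mem_powersetCard.1 ht).1 h)
  have hdisj : Disjoint (s.powersetCard (d + 1)) ((s.powersetCard d).image (insert a)) := by
    rw [Finset.disjoint_left]
    intro t ht ht'
    obtain ⟨u, -, rfl⟩ := Finset.mem_image.1 ht'
    exact hmem ht (Finset.mem_insert_self a u)
  rw [Finset.powersetCard_succ_insert ha, Finset.sum_union hdisj, Finset.sum_image,
    Finset.mul_sum]
  · congr 1
    exact Finset.sum_congr rfl fun t ht => Finset.prod_insert (hmem ht)
  · intro t ht u hu h
    rw [← Finset.erase_insert (hmem ht), ← Finset.erase_insert (hmem hu), h]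

/-- The signed generating series of the elementary symmetric functions is inverse to the
generating series of the complete homogeneous ones. -/
theorem mk_powersetCard_mul_mk_sym (z : ι → A) (s : Finset ι) :
    (PowerSeries.mk fun d => (-1) ^ d * ∑ t ∈ s.powersetCard d, ∏ i ∈ t, z i) *
      (PowerSeries.mk fun d => ∑ t ∈ s.sym d, ((t : Multiset ι).map z).prod) = 1 := by
  induction s using Finset.induction_on with
  | empty =>
    have hE : (PowerSeries.mk fun d =>
        (-1) ^ d * ∑ t ∈ (∅ : Finset ι).powersetCard d, ∏ i ∈ t, z i) = 1 := by
      ext d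
      rcases d with - | d
      · simp
      · have hcard : (∅ : Finset ι).powersetCard (d + 1) = ∅ :=
          Finset.powersetCard_eq_empty.2 (by simp)
        simp [PowerSeries.coeff_one, hcard]
    have hH : (PowerSeries.mk fun d =>
        ∑ t ∈ (∅ : Finset ι).sym d, ((t : Multiset ι).map z).prod) = 1 := by
      ext d
      cases d
      · simp only [PowerSeries.coeff_mk, Finset.sym_zero, Finset.sum_singleton]
        simp [EmptyCollection.emptyCollection]
      · simp [PowerSeries.coeff_one]
    rw [hE, hH, one_mul]
  | insert a s ha ih =>
    have hE : (PowerSeries.mk fun d =>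
          (-1) ^ d * ∑ t ∈ (insert a s).powersetCard d, ∏ i ∈ t, z i) =
        (PowerSeries.mk fun d => (-1) ^ d * ∑ t ∈ s.powersetCard d, ∏ i ∈ t, z i) *
          (1 - PowerSeries.C (z a) * PowerSeries.X) := by
      ext d
      cases d with
      | zero => simp [mul_sub]
      | succ d =>
        rw [mul_sub, mul_one, mul_left_comm, map_sub, PowerSeries.coeff_C_mul,
          PowerSeries.coeff_succ_mul_X]
        simp only [PowerSeries.coeff_mk, sum_powersetCard_insert_succ z ha]
        ring
    have hH : (1 - PowerSeries.C (z a) * PowerSeries.X) *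
          (PowerSeries.mk fun d => ∑ t ∈ (insert a s).sym d, ((t : Multiset ι).map z).prod) =
        PowerSeries.mk fun d => ∑ t ∈ s.sym d, ((t : Multiset ι).map z).prod := by
      ext d
      cases d with
      | zero => simp [sub_mul, mul_assoc]
      | succ d =>
        rw [sub_mul, one_mul, mul_assoc, map_sub, PowerSeries.coeff_C_mul,
          PowerSeries.coeff_succ_X_mul]
        simp only [PowerSeries.coeff_mk, sum_sym_insert_succ z ha]
        ring
    rw [hE, mul_assoc, hH, ih]

end Duality

section HSym

variable {ι κ A B : Type*} [Fintype ι] [DecidableEq ι] [Fintype κ] [DecidableEq κ]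
  [CommRing A] [CommRing B]

theorem map_hsym {F : Type*} [FunLike F A B] [RingHomClass F A B] (f : F) (d : ℕ) (z : ι → A) :
    f (hsym d z) = hsym d fun i => f (z i) := by
  simp [hsym, map_sum, map_multiset_prod, Multiset.map_map]

theorem hsym_eq_aeval_hsymm (d : ℕ) (z : ι → A) : hsym d z = aeval z (hsymm ι ℤ d) := by
  simp [hsym, hsymm, map_sum, map_multiset_prod, Multiset.map_map]

theorem hsym_comp_equiv (d : ℕ) (e : ι ≃ κ) (z : κ → A) :
    hsym d (fun i => z (e i)) = hsym d z := by
  rw [hsym_eq_aeval_hsymm, hsym_eq_aeval_hsymm, ← rename_hsymm ι ℤ d e, aeval_rename]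
  rfl

theorem hsym_zero (z : ι → A) : hsym 0 z = 1 := by
  simp [hsym_eq_aeval_hsymm]

theorem sum_antidiagonal_esymm_mul_hsym (R : Type*) [CommRing R] {d : ℕ} (hd : d ≠ 0) :
    ∑ p ∈ Finset.HasAntidiagonal.antidiagonal d, (-1) ^ p.1 * esymm ι R p.1 *
      hsym p.2 (X : ι → MvPolynomial ι R) = 0 := by
  have h := congrArg (PowerSeries.coeff d)
    (mk_powersetCard_mul_mk_sym (X : ι → MvPolynomial ι R) Finset.univ)
  simp only [PowerSeries.coeff_mul, PowerSeries.coeff_mk, PowerSeries.coeff_one, hd,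
    if_false] at h
  exact h

end HSym

theorem RingHom.injective_of_surjective_of_isNoetherianRing {R : Type*} [CommRing R]
    [IsNoetherianRing R] (f : R →+* R) (hf : Function.Surjective f) : Function.Injective f := by
  let c : ℕ →o Ideal R := ⟨fun k => RingHom.ker (f ^ k), monotone_nat_of_le_succ fun k x hx => by
    rw [RingHom.mem_ker] at hx ⊢
    rw [pow_succ', RingHom.mul_def, RingHom.comp_apply, hx, map_zero]⟩
  obtain ⟨k, hk⟩ := monotone_stabilizes_iff_noetherian.2 ‹IsNoetherianRing R› c
  rw [injective_iff_map_eq_zero]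
  intro x hx
  have hsurj : Function.Surjective (f ^ k) := by
    rw [RingHom.coe_pow]
    exact hf.iterate k
  obtain ⟨y, rfl⟩ := hsurj x
  have hy : y ∈ c (k + 1) := by
    change y ∈ RingHom.ker (f ^ (k + 1))
    rw [RingHom.mem_ker, pow_succ', RingHom.mul_def, RingHom.comp_apply, hx]
  rw [← hk (k + 1) k.le_succ] at hy
  exact hy

section HSymAlgHom

variable (N : ℕ) (R : Type*) [CommRing R]

/-- The algebra endomorphism of `R[x₁,…,x_N]` sending the `i`-th variable to the complete
homogeneous symmetric polynomial of degree `i`. -/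
noncomputable def hsymAlgHom : MvPolynomial (Fin N) R →ₐ[R] MvPolynomial (Fin N) R :=
  aeval fun i : Fin N => hsym (i.1 + 1) (X : Fin N → MvPolynomial (Fin N) R)

theorem hsymAlgHom_X (i : Fin N) :
    hsymAlgHom N R (X i) = hsym (i.1 + 1) (X : Fin N → MvPolynomial (Fin N) R) :=
  aeval_X _ _

variable {N R}

theorem rename_hsym_X (e : Equiv.Perm (Fin N)) (d : ℕ) :
    rename e (hsym d (X : Fin N → MvPolynomial (Fin N) R)) = hsym d X := by
  rw [map_hsym]
  simp only [rename_X]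
  exact hsym_comp_equiv d e X

theorem hsymAlgHom_isSymmetric (p : MvPolynomial (Fin N) R) :
    (hsymAlgHom N R p).IsSymmetric := fun e => by
  have h : (rename e).comp (hsymAlgHom N R) = hsymAlgHom N R := by
    ext i : 1
    simp [hsymAlgHom_X, rename_hsym_X]
  exact DFunLike.congr_fun h p

theorem esymm_mem_range_hsymAlgHom {d : ℕ} (hd : d ≤ N) :
    esymm (Fin N) R d ∈ (hsymAlgHom N R).range := by
  induction d using Nat.strong_induction_on with
  | _ d ih =>
    rcases d with - | d
    · rw [esymm_zero]
      exact one_mem _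
    · have h := sum_antidiagonal_esymm_mul_hsym (ι := Fin N) R d.succ_ne_zero
      rw [Finset.Nat.sum_antidiagonal_eq_sum_range_succ_mk, Finset.sum_range_succ, Nat.sub_self,
        hsym_zero, mul_one, add_eq_zero_iff_eq_neg'] at h
      have hmem : (-1) ^ (d + 1) * esymm (Fin N) R (d + 1) ∈ (hsymAlgHom N R).range := by
        rw [h]
        refine neg_mem (sum_mem fun k hk => ?_)
        have hk' := Finset.mem_range.1 hk
        refine mul_mem (mul_mem (pow_mem (neg_mem (one_mem _)) _) (ih k hk' (by omega))) ?_
        refine ⟨X ⟨d - k, by omega⟩, ?_⟩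
        change hsymAlgHom N R _ = _
        rw [hsymAlgHom_X]
        congr 1
        simp only
        omega
      have hsq : (-1) ^ (d + 1) * ((-1) ^ (d + 1) * esymm (Fin N) R (d + 1)) =
          esymm (Fin N) R (d + 1) := by
        rw [← mul_assoc, ← mul_pow]
        simp
      rw [← hsq]
      exact mul_mem (pow_mem (neg_mem (one_mem _)) _) hmem

theorem exists_hsymAlgHom_eq {p : MvPolynomial (Fin N) R} (hp : p.IsSymmetric) :
    ∃ q, hsymAlgHom N R q = p := by
  obtain ⟨q, hq⟩ := (esymmAlgHom_fin_bijective R N).2 ⟨p, hp⟩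
  have hq' : aeval (fun i : Fin N => esymm (Fin N) R (i + 1)) q = p := by
    rw [← esymmAlgHom_apply, hq]
  choose g hg using fun i : Fin N =>
    esymm_mem_range_hsymAlgHom (R := R) (Nat.succ_le_of_lt i.2)
  refine ⟨aeval g q, ?_⟩
  rw [← hq', ← AlgHom.comp_apply, comp_aeval]
  congr 2
  exact _root_.funext hg

theorem hsymAlgHom_injective [IsNoetherianRing R] : Function.Injective (hsymAlgHom N R) := by
  let E := AlgEquiv.ofBijective _ (esymmAlgHom_fin_bijective R N)
  let φ : MvPolynomial (Fin N) R →ₐ[R] symmetricSubalgebra (Fin N) R :=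
    (hsymAlgHom N R).codRestrict _ hsymAlgHom_isSymmetric
  have hφ : Function.Surjective φ := fun p => by
    obtain ⟨q, hq⟩ := exists_hsymAlgHom_eq p.2
    exact ⟨q, Subtype.ext hq⟩
  have hinj := RingHom.injective_of_surjective_of_isNoetherianRing
    (E.symm.toAlgHom.comp φ).toRingHom (E.symm.surjective.comp hφ)
  intro p q hpq
  exact hinj (congrArg E.symm (Subtype.ext hpq : φ p = φ q))

end HSymAlgHom

section TwoFamilies

variable (M N : ℕ) (R : Type*) [CommRing R]

/-- The algebra endomorphism of `R[y₁,…,y_M,x₁,…,x_N]` sending the variables of each of the two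
families to the complete homogeneous symmetric polynomials in that family. -/
noncomputable def hsymSumAlgHom :
    MvPolynomial (Fin M ⊕ Fin N) R →ₐ[R] MvPolynomial (Fin M ⊕ Fin N) R :=
  aeval (Sum.elim
    (fun j : Fin M => hsym (j.1 + 1) fun j' : Fin M => X (Sum.inl j'))
    (fun i : Fin N => hsym (i.1 + 1) fun i' : Fin N => X (Sum.inr i')))

variable {M N R}

theorem sumAlgEquiv_hsymSumAlgHom (p : MvPolynomial (Fin M ⊕ Fin N) R) :
    sumAlgEquiv R (Fin M) (Fin N) (hsymSumAlgHom M N R p) =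
      hsymAlgHom M (MvPolynomial (Fin N) R)
        (mapAlgHom (hsymAlgHom N R) (sumAlgEquiv R (Fin M) (Fin N) p)) := by
  have h : (sumAlgEquiv R (Fin M) (Fin N)).toAlgHom.comp (hsymSumAlgHom M N R) =
      ((hsymAlgHom M (MvPolynomial (Fin N) R)).restrictScalars R).comp
        ((mapAlgHom (hsymAlgHom N R)).comp
          (sumAlgEquiv R (Fin M) (Fin N)).toAlgHom) := by
    ext k : 1
    rcases k with j | i
    · simp [hsymSumAlgHom, hsymAlgHom_X, map_hsym]
    · simp [hsymSumAlgHom, hsymAlgHom_X, map_hsym, ← algebraMap_eq]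
  exact DFunLike.congr_fun h p

theorem hsymSumAlgHom_injective [IsNoetherianRing R] :
    Function.Injective (hsymSumAlgHom M N R) := by
  intro p q hpq
  have h := congrArg (sumAlgEquiv R (Fin M) (Fin N)) hpq
  rw [sumAlgEquiv_hsymSumAlgHom, sumAlgEquiv_hsymSumAlgHom] at h
  exact (sumAlgEquiv R (Fin M) (Fin N)).injective
    (map_injective _ hsymAlgHom_injective (hsymAlgHom_injective h))

theorem sumAlgEquiv_rename_inl (e : Equiv.Perm (Fin M)) (p : MvPolynomial (Fin M ⊕ Fin N) R) :
    sumAlgEquiv R (Fin M) (Fin N) (rename (Sum.map e id) p) =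
      rename e (sumAlgEquiv R (Fin M) (Fin N) p) := by
  have h : (sumAlgEquiv R (Fin M) (Fin N)).toAlgHom.comp (rename (Sum.map e id)) =
      ((rename e).restrictScalars R).comp (sumAlgEquiv R (Fin M) (Fin N)).toAlgHom := by
    ext k : 1
    rcases k with j | i <;> simp
  exact DFunLike.congr_fun h p

theorem sumAlgEquiv_rename_inr (e : Equiv.Perm (Fin N)) (p : MvPolynomial (Fin M ⊕ Fin N) R) :
    sumAlgEquiv R (Fin M) (Fin N) (rename (Sum.map id e) p) =
      mapAlgHom (rename e) (sumAlgEquiv R (Fin M) (Fin N) p) := by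
  have h : (sumAlgEquiv R (Fin M) (Fin N)).toAlgHom.comp (rename (Sum.map id e)) =
      (mapAlgHom (rename e)).comp (sumAlgEquiv R (Fin M) (Fin N)).toAlgHom := by
    ext k : 1
    rcases k with j | i <;> simp
  exact DFunLike.congr_fun h p

theorem map_hsymAlgHom {S T : Type*} [CommRing S] [CommRing T] (f : S →+* T)
    (p : MvPolynomial (Fin N) S) :
    map f (hsymAlgHom N S p) = hsymAlgHom N T (map f p) := by
  have h : (map f).comp (hsymAlgHom N S).toRingHom =
      (hsymAlgHom N T).toRingHom.comp (map f) := by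
    ext i : 1
    · ext; simp
    · simp [hsymAlgHom_X, map_hsym]
  exact DFunLike.congr_fun h p

/-- A polynomial symmetric in each of two families of variables is a polynomial in the complete
homogeneous symmetric polynomials of the two families. -/
theorem exists_hsymSumAlgHom_eq [IsNoetherianRing R] {p : MvPolynomial (Fin M ⊕ Fin N) R}
    (hl : ∀ e : Equiv.Perm (Fin M), rename (Sum.map e id) p = p)
    (hr : ∀ e : Equiv.Perm (Fin N), rename (Sum.map id e) p = p) :
    ∃ q, hsymSumAlgHom M N R q = p := by
  obtain ⟨Q, hQ⟩ := exists_hsymAlgHom_eq (p := sumAlgEquiv R (Fin M) (Fin N) p) fun e => by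
    rw [← sumAlgEquiv_rename_inl, hl]
  have hcoeff (e : Equiv.Perm (Fin N)) :
      map (rename e : MvPolynomial (Fin N) R →ₐ[R] _).toRingHom Q = Q := by
    apply hsymAlgHom_injective
    rw [← map_hsymAlgHom, hQ]
    exact (sumAlgEquiv_rename_inr e p).symm.trans (by rw [hr])
  have hrange : Q ∈ (map (σ := Fin M) (hsymAlgHom N R).toRingHom).range := by
    rw [RingHom.mem_range, ← Set.mem_range, mem_range_map_iff_coeffs_subset]
    intro c hc
    obtain ⟨k, -, rfl⟩ := mem_coeffs_iff.1 hc
    refine exists_hsymAlgHom_eq fun e => ?_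
    conv_rhs => rw [← hcoeff e, coeff_map]
    rfl
  obtain ⟨Q', rfl⟩ := hrange
  refine ⟨(sumAlgEquiv R (Fin M) (Fin N)).symm Q',
    (sumAlgEquiv R (Fin M) (Fin N)).injective ?_⟩
  rw [sumAlgEquiv_hsymSumAlgHom, AlgEquiv.apply_symm_apply]
  exact hQ

end TwoFamilies

/-- For `m, n ≥ 1` there is a unique polynomial `P^{m,n}` in variables
`Y₁,…,Y_m, X₁,…,X_{mn}` over `ℤ` such that, in `ℤ[y₁,…,y_m,x₁,…,x_{mn}]`,
the complete homogeneous symmetric polynomial `h_m` of the family of all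
products `y_j·x_{i₁}·⋯·x_{i_n}` (with `1 ≤ j ≤ m` and `i₁ ≤ ⋯ ≤ i_n`)
equals `P^{m,n}(h₁(y),…,h_m(y),h₁(x),…,h_{mn}(x))`. -/
theorem exists_unique_P (m n : ℕ) (hm : 1 ≤ m) (hn : 1 ≤ n) :
    ∃! P : MvPolynomial (Fin m ⊕ Fin (m * n)) ℤ,
      MvPolynomial.aeval
        (Sum.elim
          (fun j : Fin m =>
            hsym (j.1 + 1)
              (fun j' : Fin m =>
                (MvPolynomial.X (Sum.inl j') : MvPolynomial (Fin m ⊕ Fin (m * n)) ℤ)))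
          (fun i : Fin (m * n) =>
            hsym (i.1 + 1)
              (fun i' : Fin (m * n) =>
                (MvPolynomial.X (Sum.inr i') : MvPolynomial (Fin m ⊕ Fin (m * n)) ℤ))))
        P =
      hsym m
        (fun p : Fin m × Sym (Fin (m * n)) n =>
          MvPolynomial.X (Sum.inl p.1) *
            ((p.2 : Multiset (Fin (m * n))).map fun i =>
              (MvPolynomial.X (Sum.inr i) : MvPolynomial (Fin m ⊕ Fin (m * n)) ℤ)).prod) := by
  refine existsUnique_of_exists_of_unique ?_ fun P Q hP hQ =>
    hsymSumAlgHom_injective (hP.trans hQ.symm)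
  refine exists_hsymSumAlgHom_eq (fun e => ?_) fun e => ?_
  · rw [map_hsym]
    refine Eq.trans ?_ (hsym_comp_equiv m (e.prodCongr (Equiv.refl _)) _)
    simp [map_multiset_prod, Multiset.map_map, Function.comp_def]
  · rw [map_hsym]
    refine Eq.trans ?_ (hsym_comp_equiv m ((Equiv.refl _).prodCongr (Sym.equivCongr e)) _)
    simp [map_multiset_prod, Multiset.map_map, Function.comp_def]
end

section
/- Let R be a commutative ring, a ∈ R, M an R-module and x ∈ M, and let n₁, …, n_k (k ≥ 1) be positive integers with greatest common divisor g. Then [nᵢ]_a · x = 0 holds for all i = 1, …, k if and only if [g]_a · x = 0. In particular, if [g]_a · x = 0 then [m]_a · x = 0 for every positive integer m divisible by g. -/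
section GeomSum

variable {R M : Type*} [CommRing R] [AddCommGroup M] [Module R M] {a : R} {x : M}

theorem geom_sum_smul_eq_zero_of_dvd {g m : ℕ} (hgm : g ∣ m)
    (hg : (∑ j ∈ Finset.range g, a ^ j) • x = 0) :
    (∑ j ∈ Finset.range m, a ^ j) • x = 0 := by
  obtain ⟨q, rfl⟩ := hgm
  induction q with
  | zero => simp
  | succ q ih =>
    rw [Nat.mul_succ, Finset.sum_range_add]
    simp only [pow_add, ← Finset.mul_sum]
    rw [add_smul, ih, mul_smul, hg, smul_zero, add_zero]

theorem geom_sum_mod_smul {m : ℕ} (n : ℕ)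
    (hm : (∑ j ∈ Finset.range m, a ^ j) • x = 0) :
    (∑ j ∈ Finset.range (n % m), a ^ j) • x = (∑ j ∈ Finset.range n, a ^ j) • x := by
  conv_rhs => rw [← Nat.mod_add_div n m, Finset.sum_range_add]
  simp only [pow_add, ← Finset.mul_sum]
  rw [add_smul, mul_smul, geom_sum_smul_eq_zero_of_dvd (dvd_mul_right m (n / m)) hm,
    smul_zero, add_zero]

theorem geom_sum_gcd_smul_eq_zero {m n : ℕ}
    (hm : (∑ j ∈ Finset.range m, a ^ j) • x = 0)
    (hn : (∑ j ∈ Finset.range n, a ^ j) • x = 0) :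
    (∑ j ∈ Finset.range (m.gcd n), a ^ j) • x = 0 := by
  induction m, n using Nat.gcd.induction with
  | H0 n => simpa using hn
  | H1 m n _ ih =>
    rw [Nat.gcd_rec]
    exact ih ((geom_sum_mod_smul n hm).trans hn) hm

theorem geom_sum_finset_gcd_smul_eq_zero {ι : Type*} (s : Finset ι) (n : ι → ℕ)
    (h : ∀ i ∈ s, (∑ j ∈ Finset.range (n i), a ^ j) • x = 0) :
    (∑ j ∈ Finset.range (s.gcd n), a ^ j) • x = 0 := by
  classical
  induction s using Finset.induction_on with
  | empty => simp
  | insert i s _ ih =>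
    rw [Finset.gcd_insert]
    exact geom_sum_gcd_smul_eq_zero (h i (Finset.mem_insert_self i s))
      (ih fun l hl => h l (Finset.mem_insert_of_mem hl))

end GeomSum


/-- For `a ∈ R` and positive integers `n₁, …, n_k` with gcd `g`, an element
`x` of an `R`-module satisfies `[nᵢ]_a · x = 0` for all `i` iff `[g]_a · x = 0`
(where `[k]_a = 1 + a + ⋯ + a^{k−1}`); in particular `[g]_a · x = 0` implies
`[m]_a · x = 0` for every positive `m` divisible by `g`. -/
theorem geom_sum_smul_eq_zero_iff_gcd {R M : Type*} [CommRing R]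
    [AddCommGroup M] [Module R M] (a : R) (x : M)
    (k : ℕ) (hk : 1 ≤ k) (n : Fin k → ℕ) (hn : ∀ i, 0 < n i) :
    ((∀ i : Fin k, (∑ j ∈ Finset.range (n i), a ^ j) • x = 0) ↔
      (∑ j ∈ Finset.range (Finset.univ.gcd n), a ^ j) • x = 0) ∧
    (∀ m : ℕ, 0 < m → Finset.univ.gcd n ∣ m →
      (∑ j ∈ Finset.range (Finset.univ.gcd n), a ^ j) • x = 0 →
      (∑ j ∈ Finset.range m, a ^ j) • x = 0) := by
  exact ⟨⟨fun h => geom_sum_finset_gcd_smul_eq_zero Finset.univ n fun i _ => h i,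
      fun h i => geom_sum_smul_eq_zero_of_dvd (Finset.gcd_dvd (Finset.mem_univ i)) h⟩,
    fun _ _ hm h => geom_sum_smul_eq_zero_of_dvd hm h⟩
end
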